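/- Let F ⊆ ℝ^n be convex and let f : F → ℝ^m be continuous. Suppose there are finitely many closed convex sets R^(1),…,R^(s) ⊆ ℝ^n with F ⊆ R^(1) ∪ … ∪ R^(s), each R^(i) ∩ F having nonempty interior in ℝ^n, and matrices K^(i) ∈ ℝ^{m×n} and vectors b^(i) ∈ ℝ^m such that f(x) = K^(i) x + b^(i) for all x ∈ R^(i) ∩ F and all i. Then the minimum Lipschitz constant of f on F with respect to the ∞-norm equals max_{1≤i≤s} ‖K^(i)‖_∞; that is, L* := max_{1≤i≤s} ‖K^(i)‖_∞ satisfies ‖f(x) − f(x̃)‖_∞ ≤ L* ‖x − x̃‖_∞ for all x, x̃ ∈ F, and every L with this property satisfies L ≥ L*. -/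

import Mathlib

open Matrix

/-- The induced matrix ∞-norm: maximum absolute row sum. -/
noncomputable def matNormInf {m n : ℕ} [NeZero m] (K : Matrix (Fin m) (Fin n) ℝ) : ℝ :=
  Finset.univ.sup' Finset.univ_nonempty fun i => ∑ j, |K i j|

open Filter Topology in
/-- A continuous curve whose range on `[0, 1]` is covered by finitely many closed sets, on each of
which it is `C`-Lipschitz, moves by at most `C`. -/
theorem norm_sub_le_of_finite_closed_cover {ι E : Type*} [Finite ι] [NormedAddCommGroup E]
    {g : ℝ → E} {C : ℝ} {S : ι → Set ℝ} (hg : ContinuousOn g (Set.Icc 0 1))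
    (hS : ∀ i, IsClosed (S i)) (hcover : Set.Icc 0 1 ⊆ ⋃ i, S i)
    (hlip : ∀ i, ∀ t ∈ S i ∩ Set.Icc 0 1, ∀ u ∈ S i ∩ Set.Icc 0 1,
      ‖g t - g u‖ ≤ C * |t - u|) :
    ‖g 1 - g 0‖ ≤ C := by
  have key := image_le_of_liminf_slope_right_le_deriv_boundary (f := fun t => ‖g t - g 0‖)
    (B := fun t => C * t) (B' := fun _ => C) (a := 0) (b := 1)
    (hg.sub continuousOn_const).norm (by simp) (by fun_prop)
    (fun x _ => by simpa using ((hasDerivAt_id x).const_mul C).hasDerivWithinAt) ?_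
    (Set.right_mem_Icc.2 zero_le_one)
  · simpa using key
  intro t ht r hr
  have hnear : ∀ᶠ z in 𝓝[>] t, z ∈ Set.Ioo t 1 := Ioo_mem_nhdsGT ht.2
  have hex : ∃ i, ∃ᶠ z in 𝓝[>] t, z ∈ S i := by
    by_contra! h
    have hall := eventually_all.2 h
    obtain ⟨z, hz, hz'⟩ := (hall.and hnear).exists
    obtain ⟨i, hi⟩ := Set.mem_iUnion.1 (hcover ⟨ht.1.trans hz'.1.le, hz'.2.le⟩)
    exact hz i hi
  obtain ⟨i, hi⟩ := hex
  have hti : t ∈ S i :=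
    (hS i).mem_of_frequently_of_tendsto hi (tendsto_id.mono_left nhdsWithin_le_nhds)
  refine (hi.and_eventually hnear).mono fun z ⟨hzi, hz⟩ => lt_of_le_of_lt ?_ hr
  have hpos : 0 < z - t := sub_pos.2 hz.1
  rw [slope_def_field, div_le_iff₀ hpos]
  calc ‖g z - g 0‖ - ‖g t - g 0‖ ≤ ‖(g z - g 0) - (g t - g 0)‖ := norm_sub_norm_le _ _
    _ = ‖g z - g t‖ := by rw [sub_sub_sub_cancel_right]
    _ ≤ C * |z - t| := hlip i z ⟨hzi, ht.1.trans hz.1.le, hz.2.le⟩ t ⟨hti, ht.1, ht.2.le⟩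
    _ = C * (z - t) := by rw [abs_of_pos hpos]

theorem norm_mulVec_le_matNormInf_mul {m n : ℕ} [NeZero m] (K : Matrix (Fin m) (Fin n) ℝ)
    (v : Fin n → ℝ) : ‖K.mulVec v‖ ≤ matNormInf K * ‖v‖ := by
  refine (pi_norm_le_iff_of_nonempty _).2 fun i => ?_
  calc ‖K.mulVec v i‖ ≤ ∑ j, ‖K i j * v j‖ := by
        simpa only [Matrix.mulVec, dotProduct] using norm_sum_le _ _
    _ ≤ ∑ j, |K i j| * ‖v‖ := Finset.sum_le_sum fun j _ => by
        rw [norm_mul, Real.norm_eq_abs]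
        exact mul_le_mul_of_nonneg_left (norm_le_pi_norm v j) (abs_nonneg _)
    _ = (∑ j, |K i j|) * ‖v‖ := (Finset.sum_mul _ _ _).symm
    _ ≤ matNormInf K * ‖v‖ := mul_le_mul_of_nonneg_right
        (Finset.le_sup' (fun i => ∑ j, |K i j|) (Finset.mem_univ i)) (norm_nonneg _)

theorem exists_norm_eq_one_mulVec_eq_sum_abs {m n : ℕ} [NeZero n] (K : Matrix (Fin m) (Fin n) ℝ)
    (i : Fin m) : ∃ v : Fin n → ℝ, ‖v‖ = 1 ∧ K.mulVec v i = ∑ j, |K i j| := by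
  let v : Fin n → ℝ := fun j => if 0 ≤ K i j then 1 else -1
  have hv : ∀ j, ‖v j‖ = 1 := fun j => by
    by_cases h : 0 ≤ K i j <;> simp [v, h]
  refine ⟨v, le_antisymm ((pi_norm_le_iff_of_nonempty _).2 fun j => (hv j).le) ?_, ?_⟩
  · exact (hv 0).symm.le.trans (norm_le_pi_norm v 0)
  · simp only [Matrix.mulVec, dotProduct]
    refine Finset.sum_congr rfl fun j _ => ?_
    by_cases h : 0 ≤ K i j
    · simp [v, h, abs_of_nonneg h]
    · simp [v, h, abs_of_neg (not_le.1 h)]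

/-- If `x ↦ K x + b` is `L`-Lipschitz on a set with nonempty interior, then `‖K‖_∞ ≤ L`. -/
theorem matNormInf_le_of_lipschitz {m n : ℕ} [NeZero m] [NeZero n]
    {K : Matrix (Fin m) (Fin n) ℝ} {U : Set (Fin n → ℝ)} (hU : (interior U).Nonempty) {L : ℝ}
    (hL : ∀ x ∈ U, ∀ y ∈ U, ‖K.mulVec (x - y)‖ ≤ L * ‖x - y‖) : matNormInf K ≤ L := by
  refine Finset.sup'_le _ _ fun i _ => ?_
  obtain ⟨v, hv, hKv⟩ := exists_norm_eq_one_mulVec_eq_sum_abs K i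
  obtain ⟨x, hx⟩ := hU
  obtain ⟨ε, hε, hball⟩ := Metric.isOpen_iff.1 isOpen_interior x hx
  have hδ : 0 < ε / 2 := half_pos hε
  have hy : x + (ε / 2) • v ∈ U := interior_subset <| hball <| by
    rw [Metric.mem_ball, dist_eq_norm, add_sub_cancel_left, norm_smul, hv, mul_one,
      Real.norm_of_nonneg hδ.le]
    exact half_lt_self hε
  have h := hL _ hy x (interior_subset hx)
  rw [add_sub_cancel_left, Matrix.mulVec_smul, norm_smul, norm_smul, hv, mul_one, mul_comm L,
    Real.norm_of_nonneg hδ.le] at h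
  calc ∑ j, |K i j| = K.mulVec v i := hKv.symm
    _ ≤ ‖K.mulVec v i‖ := Real.le_norm_self _
    _ ≤ ‖K.mulVec v‖ := norm_le_pi_norm _ i
    _ ≤ L := le_of_mul_le_mul_left h hδ

/-- The minimum Lipschitz constant (w.r.t. the ∞-norms, which are the sup norms
on the pi types) of a continuous PWA function on a convex domain, whose pieces
have nonempty interior, equals `max_i ‖K^(i)‖_∞`. -/
theorem stmt_16 {n m s : ℕ} [NeZero n] [NeZero m] [NeZero s]
    (F : Set (Fin n → ℝ)) (hF : Convex ℝ F)
    (f : (Fin n → ℝ) → Fin m → ℝ) (hf : ContinuousOn f F)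
    (R : Fin s → Set (Fin n → ℝ))
    (hclosed : ∀ i, IsClosed (R i)) (hconv : ∀ i, Convex ℝ (R i))
    (hcover : F ⊆ ⋃ i, R i)
    (hint : ∀ i, (interior (R i ∩ F)).Nonempty)
    (K : Fin s → Matrix (Fin m) (Fin n) ℝ) (b : Fin s → Fin m → ℝ)
    (haff : ∀ i, ∀ x ∈ R i ∩ F, f x = (K i).mulVec x + b i) :
    (∀ x ∈ F, ∀ x' ∈ F,
      ‖f x - f x'‖ ≤
        (Finset.univ.sup' Finset.univ_nonempty fun i => matNormInf (K i)) *
          ‖x - x'‖) ∧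
    (∀ L : ℝ, (∀ x ∈ F, ∀ x' ∈ F, ‖f x - f x'‖ ≤ L * ‖x - x'‖) →
      (Finset.univ.sup' Finset.univ_nonempty fun i => matNormInf (K i)) ≤ L) := by
  have hsub : ∀ i, ∀ x ∈ R i ∩ F, ∀ y ∈ R i ∩ F, f x - f y = (K i).mulVec (x - y) := by
    intro i x hx y hy
    rw [haff i x hx, haff i y hy, Matrix.mulVec_sub, add_sub_add_right_eq_sub]
  refine ⟨fun x hx x' hx' => ?_, fun L hL => ?_⟩
  · let γ : ℝ → Fin n → ℝ := AffineMap.lineMap x' x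
    have hγ : Continuous γ := AffineMap.lineMap_continuous
    have hγF : Set.MapsTo γ (Set.Icc 0 1) F := fun t ht => hF.lineMap_mem hx' hx ht
    have key := norm_sub_le_of_finite_closed_cover (g := f ∘ γ) (S := fun i => γ ⁻¹' R i)
      (C := (Finset.univ.sup' Finset.univ_nonempty fun i => matNormInf (K i)) * ‖x - x'‖)
      (hf.comp hγ.continuousOn hγF) (fun i => (hclosed i).preimage hγ)
      (fun t ht => by simpa using hcover (hγF ht)) ?_
    · simpa [γ] using key
    · rintro i t ⟨hti, ht⟩ u ⟨hui, hu⟩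
      have hdist : ‖γ t - γ u‖ = ‖x - x'‖ * |t - u| := by
        rw [← dist_eq_norm, dist_lineMap_lineMap, Real.dist_eq, dist_comm, dist_eq_norm, mul_comm]
      rw [Function.comp_apply, Function.comp_apply, hsub i _ ⟨hti, hγF ht⟩ _ ⟨hui, hγF hu⟩,
        mul_assoc, ← hdist]
      exact (norm_mulVec_le_matNormInf_mul _ _).trans <| mul_le_mul_of_nonneg_right
        (Finset.le_sup' (fun i => matNormInf (K i)) (Finset.mem_univ i)) (norm_nonneg _)
  · refine Finset.sup'_le _ _ fun i _ => matNormInf_le_of_lipschitz (hint i) fun x hx y hy => ?_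
    rw [← hsub i x hx y hy]
    exact hL x hx.2 y hy.2
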